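/- Let d ≥ 1, let μ be a stationary ergodic probability measure on 𝒮(d), and let ℰ : S(d) → S(d) be a measurable map, extended to environments by ℰ(ω)(x) = ℰ(ω(x)), such that ℰ(ω) is balanced for every ω, ℰ(ω) is elliptic for μ-a.e. ω, and ∫ c(ℰ(ω),0)^{−p} dμ(ω) < ∞ for some p > d. Then there exists a probability measure λ on 𝒮(d) such that: (i) λ and μ are mutually absolutely continuous; (ii) λ is invariant for the environment kernel K^ℰ(ω,·) = Σ_{v∈V_d} ℰ(ω)(0,v) δ_{τ_v ω}, i.e. ∫ K^ℰ(ω,B) dλ(ω) = λ(B) for every measurable B ⊆ 𝒮(d); and (iii) the kernel is ergodic under λ: every measurable B with K^ℰ(ω,B) = 1_B(ω) for λ-a.e. ω satisfies λ(B) ∈ {0,1}. -/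

import Mathlib

open MeasureTheory Filter Topology
open scoped ENNReal NNReal

noncomputable section

abbrev Zd (d : ℕ) := Fin d → ℤ

/-- The `i`-th standard unit vector of `ℤ^d`. -/
def eZ (d : ℕ) (i : Fin d) : Zd d := Pi.single i 1

/-- `V_d = {±e_1, …, ±e_d, 0}`. -/
def Vfin (d : ℕ) : Finset (Zd d) :=
  ((Finset.univ.image fun i : Fin d => eZ d i) ∪
    (Finset.univ.image fun i : Fin d => -eZ d i)) ∪ {0}

/-- `S(d)`: probability vectors indexed by `V_d` (as functions on `ℤ^d` supported on `V_d`). -/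
def Sd (d : ℕ) : Set (Zd d → ℝ) :=
  {p | (∀ v, 0 ≤ p v) ∧ (∀ v ∉ Vfin d, p v = 0) ∧ ∑ v ∈ Vfin d, p v = 1}

/-- `𝒮(d)`: environments, i.e. maps `ℤ^d → S(d)`, with the product σ-algebra. -/
abbrev Env (d : ℕ) := Zd d → Sd d

/-- The shift `τ_x` on environments. -/
def shiftE {d : ℕ} (x : Zd d) (ω : Env d) : Env d := fun y => ω (x + y)

/-- `μ` is stationary and ergodic with respect to the group of shifts. -/
def StationaryErgodic {d : ℕ} (μ : Measure (Env d)) : Prop :=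
  (∀ x : Zd d, Measure.map (shiftE x) μ = μ) ∧
  ∀ B : Set (Env d), MeasurableSet B → (∀ x : Zd d, shiftE x ⁻¹' B = B) →
    μ B = 0 ∨ μ B = 1

/-- The environment kernel `K^ℰ(ω, B) = Σ_{v ∈ V_d} ℰ(ω)(0,v) δ_{τ_v ω}(B)`. -/
def Kker (d : ℕ) (E : Sd d → Sd d) (ω : Env d) (B : Set (Env d)) : ℝ≥0∞ :=
  ∑ v ∈ Vfin d, ENNReal.ofReal ((E (ω 0)).1 v) *
    B.indicator (fun _ => (1 : ℝ≥0∞)) (shiftE v ω)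

/-- `c(ℰ(ω), x) = (∏_{v ∈ V_d ∖ {0}} ℰ(ω)(x,v))^{1/(2d)}`. -/
def cE (d : ℕ) (E : Sd d → Sd d) (ω : Env d) (x : Zd d) : ℝ :=
  (∏ v ∈ (Vfin d).erase 0, (E (ω x)).1 v) ^ (2 * (d : ℝ))⁻¹

section Geometry

variable {d : ℕ}

lemma eZ_injective : Function.Injective (eZ d) := fun i j h => by
  have := congrFun h i
  by_contra hij
  simp [eZ, hij] at this

lemma eZ_ne_neg_eZ (i j : Fin d) : eZ d i ≠ -eZ d j := fun h => by
  have := congrFun h i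
  simp only [eZ, Pi.single_apply, Pi.neg_apply, if_true] at this
  grind

lemma eZ_ne_zero (i : Fin d) : eZ d i ≠ 0 := fun h => by
  have := congrFun h i
  simp [eZ] at this

lemma eZ_mem_Vfin (i : Fin d) : eZ d i ∈ Vfin d := by simp [Vfin]

lemma zero_mem_Vfin : (0 : Zd d) ∈ Vfin d := by simp [Vfin]

@[to_additive]
lemma prod_Vfin_erase {M : Type*} [CommMonoid M] (g : Zd d → M) :
    ∏ v ∈ (Vfin d).erase 0, g v = ∏ i, (g (eZ d i) * g (-eZ d i)) := by
  have hV : (Vfin d).erase 0 = (Finset.univ.image fun i : Fin d => eZ d i) ∪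
      (Finset.univ.image fun i : Fin d => -eZ d i) := by
    rw [Vfin, Finset.union_comm, ← Finset.insert_eq, Finset.erase_insert]
    simp [eZ_ne_zero]
  rw [hV, Finset.prod_union, Finset.prod_image, Finset.prod_image, Finset.prod_mul_distrib]
  · exact fun i _ j _ h => eZ_injective (neg_injective h)
  · exact fun i _ j _ h => eZ_injective h
  · simp only [Finset.disjoint_left, Finset.mem_image, Finset.mem_univ, true_and]
    rintro _ ⟨i, rfl⟩ ⟨j, hj⟩
    exact eZ_ne_neg_eZ i j hj.symm

lemma sum_Vfin {M : Type*} [AddCommMonoid M] (g : Zd d → M) :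
    ∑ v ∈ Vfin d, g v = ∑ i, (g (eZ d i) + g (-eZ d i)) + g 0 := by
  rw [← Finset.sum_erase_add _ _ zero_mem_Vfin, sum_Vfin_erase]

/-- The lattice points all of whose coordinates are smaller than `L` in absolute value. -/
def cube (d L : ℕ) : Finset (Zd d) :=
  Fintype.piFinset fun _ => Finset.Ioo (-(L : ℤ)) L

lemma mem_cube {L : ℕ} {x : Zd d} : x ∈ cube d L ↔ ∀ i, |x i| < L := by
  simp [cube, abs_lt]

lemma zero_mem_cube {L : ℕ} (hL : 0 < L) : (0 : Zd d) ∈ cube d L := by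
  simpa [mem_cube] using fun _ => hL

lemma card_cube_le (d L : ℕ) : (cube d L).card ≤ (2 * L) ^ d := by
  simp only [cube, Fintype.card_piFinset, Int.card_Ioo, Finset.prod_const, Finset.card_univ,
    Fintype.card_fin]
  exact Nat.pow_le_pow_left (by omega) d

lemma sq_le_sum_sq_of_notMem_cube {L : ℕ} {x : Zd d} (hx : x ∉ cube d L) :
    (L : ℝ) ^ 2 ≤ ∑ i, (x i : ℝ) ^ 2 := by
  simp only [mem_cube, not_forall, not_lt] at hx
  obtain ⟨i, hi⟩ := hx
  have h : (L : ℝ) ≤ |(x i : ℝ)| := by exact_mod_cast hi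
  calc (L : ℝ) ^ 2 ≤ |(x i : ℝ)| ^ 2 := by gcongr
    _ = (x i : ℝ) ^ 2 := sq_abs _
    _ ≤ _ := Finset.single_le_sum (f := fun i => (x i : ℝ) ^ 2) (fun _ _ => sq_nonneg _)
      (Finset.mem_univ i)

lemma abs_le_of_mem_cube_of_abs_sub_le {L : ℕ} {x y : Zd d} (hx : x ∈ cube d L)
    (hxy : ∀ i, |y i - x i| ≤ 1) (i : Fin d) : |(y i : ℝ)| ≤ L := by
  have h1 := mem_cube.1 hx i
  have h2 := hxy i
  have : |y i| ≤ (L : ℤ) := by rw [abs_le] at *; rw [abs_lt] at h1; constructor <;> omega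
  exact_mod_cast this

lemma abs_eZ_le_one (i j : Fin d) : |eZ d i j| ≤ 1 := by
  simp only [eZ, Pi.single_apply]
  split_ifs <;> simp

end Geometry

section MaximumPrinciple

variable {d : ℕ}

lemma prod_le_of_sum_mul_le {a l : Fin d → ℝ} {f : ℝ} (hd : 0 < d) (ha : ∀ i, 0 < a i)
    (hl : ∀ i, 0 ≤ l i) (h : ∑ i, a i * l i ≤ f) :
    ∏ i, l i ≤ (f / d) ^ d / ∏ i, a i := by
  have hd' : (0 : ℝ) < d := by exact_mod_cast hd
  have hal : ∀ i, 0 ≤ a i * l i := fun i => mul_nonneg (ha i).le (hl i)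
  rw [le_div_iff₀ (Finset.prod_pos fun i _ => ha i), mul_comm, ← Finset.prod_mul_distrib]
  have h1 := Real.geom_mean_le_arith_mean Finset.univ (fun _ => (1 : ℝ)) (fun i => a i * l i)
    (fun _ _ => zero_le_one) (by simpa using hd) (fun i _ => hal i)
  simp only [Real.rpow_one, Finset.sum_const, Finset.card_univ, Fintype.card_fin, nsmul_eq_mul,
    mul_one, one_mul] at h1
  have hp : 0 ≤ ∏ i, a i * l i := Finset.prod_nonneg fun i _ => hal i
  calc ∏ i, a i * l i = ((∏ i, a i * l i) ^ (d : ℝ)⁻¹) ^ d :=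
        (Real.rpow_inv_natCast_pow hp hd.ne').symm
    _ ≤ (f / d) ^ d := by
        gcongr
        exact h1.trans (by gcongr)

/-- If `u` vanishes off the cube, every slope that is small compared with `u 0` is a supporting
slope of `u` at some point of the cube. -/
lemma exists_mem_cube_supporting_slope {L : ℕ} (hL : 0 < L) {u : Zd d → ℝ}
    (hu : ∀ x ∉ cube d L, u x = 0) {ξ : Fin d → ℝ} (hξ : (∑ i, |ξ i|) * L < u 0) :
    ∃ x ∈ cube d L, ∀ i, u (x + eZ d i) - u x ≤ ξ i ∧ ξ i ≤ u x - u (x - eZ d i) := by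
  obtain ⟨x, hx, hmax⟩ := (cube d L).exists_max_image (fun x => u x - ∑ i, ξ i * x i)
    ⟨0, zero_mem_cube hL⟩
  have key : ∀ y : Zd d, (∀ i, |y i - x i| ≤ 1) →
      u y - ∑ i, ξ i * y i ≤ u x - ∑ i, ξ i * x i := by
    intro y hy
    by_cases hyQ : y ∈ cube d L
    · exact hmax y hyQ
    · have h0 := hmax 0 (zero_mem_cube hL)
      simp only [Pi.zero_apply, Int.cast_zero, mul_zero, Finset.sum_const_zero, sub_zero] at h0
      refine le_trans ?_ h0
      rw [hu y hyQ, zero_sub]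
      refine le_trans ?_ hξ.le
      rw [Finset.sum_mul, ← Finset.sum_neg_distrib]
      refine Finset.sum_le_sum fun i _ => ?_
      calc -(ξ i * y i) ≤ |ξ i * y i| := neg_le_abs _
        _ = |ξ i| * |(y i : ℝ)| := abs_mul _ _
        _ ≤ |ξ i| * L := by
          gcongr
          exact abs_le_of_mem_cube_of_abs_sub_le hx hy i
  have hsum : ∀ i, ∑ j, ξ j * (eZ d i j : ℝ) = ξ i := fun i => by
    simp [eZ, Pi.single_apply]
  refine ⟨x, hx, fun i => ⟨?_, ?_⟩⟩
  · have := key (x + eZ d i) fun j => by simpa using abs_eZ_le_one i j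
    simp only [Pi.add_apply, Int.cast_add, mul_add, Finset.sum_add_distrib, hsum] at this
    linarith
  · have := key (x - eZ d i) fun j => by simpa using abs_eZ_le_one i j
    simp only [Pi.sub_apply, Int.cast_sub, mul_sub, Finset.sum_sub_distrib, hsum] at this
    linarith

/-- The discrete Alexandrov–Bakelman–Pucci maximum principle for balanced operators. -/
theorem discrete_abp (hd : 0 < d) {L : ℕ} (hL : 0 < L) {u f : Zd d → ℝ} {a : Zd d → Fin d → ℝ}
    (hu : ∀ x ∉ cube d L, u x = 0) (hu0 : 0 ≤ u 0) (hf : ∀ x, 0 ≤ f x)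
    (ha : ∀ x i, 0 < a x i)
    (h : ∀ x ∈ cube d L, ∑ i, a x i * (2 * u x - u (x + eZ d i) - u (x - eZ d i)) ≤ f x) :
    (2 * u 0 / L) ^ d ≤ ∑ x ∈ cube d L, f x ^ d / ∏ i, a x i := by
  have hd' : (0 : ℝ) < d := by exact_mod_cast hd
  have hL' : (0 : ℝ) < L := by exact_mod_cast hL
  set r := u 0 / (d * L) with hr
  have hr0 : 0 ≤ r := by positivity
  have hA : ∀ x, 0 < ∏ i, a x i := fun x => Finset.prod_pos fun i _ => ha x i
  have hcover : (Set.univ.pi fun _ : Fin d => Set.Ioo (-r) r) ⊆ ⋃ x ∈ cube d L,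
      Set.Icc (fun i => u (x + eZ d i) - u x) (fun i => u x - u (x - eZ d i)) := by
    intro ξ hξ
    have hlt : (∑ i, |ξ i|) * L < u 0 := by
      have : ∑ i, |ξ i| < ∑ _i : Fin d, r :=
        Finset.sum_lt_sum_of_nonempty ⟨⟨0, hd⟩, Finset.mem_univ _⟩
          fun i _ => abs_lt.2 (hξ i (Set.mem_univ i))
      rw [Finset.sum_const, Finset.card_univ, Fintype.card_fin, nsmul_eq_mul] at this
      calc (∑ i, |ξ i|) * L < d * r * L := by gcongr
        _ = u 0 := by rw [hr]; field_simp
    obtain ⟨x, hx, hx'⟩ := exists_mem_cube_supporting_slope hL hu hlt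
    simp only [Set.mem_iUnion]
    exact ⟨x, hx, fun i => (hx' i).1, fun i => (hx' i).2⟩
  have hbox : ∀ x ∈ cube d L, volume (Set.Icc (fun i => u (x + eZ d i) - u x)
      (fun i => u x - u (x - eZ d i))) ≤ ENNReal.ofReal ((f x / d) ^ d / ∏ i, a x i) := by
    intro x hx
    rw [Real.volume_Icc_pi]
    have hl : ∀ i, u x - u (x - eZ d i) - (u (x + eZ d i) - u x) =
      2 * u x - u (x + eZ d i) - u (x - eZ d i) := fun i => by ring
    simp only [hl]
    by_cases hpos : ∀ i, 0 ≤ 2 * u x - u (x + eZ d i) - u (x - eZ d i)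
    · rw [← ENNReal.ofReal_prod_of_nonneg fun i _ => hpos i]
      exact ENNReal.ofReal_le_ofReal (prod_le_of_sum_mul_le hd (ha x) hpos (h x hx))
    · push Not at hpos
      obtain ⟨i, hi⟩ := hpos
      rw [Finset.prod_eq_zero (Finset.mem_univ i) (ENNReal.ofReal_of_nonpos hi.le)]
      exact zero_le
  have hvol := (measure_mono hcover).trans
    ((measure_biUnion_finset_le _ _).trans (Finset.sum_le_sum hbox))
  rw [Real.volume_pi_Ioo, Finset.prod_const, Finset.card_univ, Fintype.card_fin,
    ← ENNReal.ofReal_pow (by linarith), ← ENNReal.ofReal_sum_of_nonneg fun x _ =>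
      div_nonneg (pow_nonneg (div_nonneg (hf x) hd'.le) _) (hA x).le,
    ENNReal.ofReal_le_ofReal_iff (Finset.sum_nonneg fun x _ =>
      div_nonneg (pow_nonneg (div_nonneg (hf x) hd'.le) _) (hA x).le)] at hvol
  calc (2 * u 0 / L) ^ d = d ^ d * (r - -r) ^ d := by
        rw [← mul_pow, hr]; congr 1; field_simp; ring
    _ ≤ d ^ d * ∑ x ∈ cube d L, (f x / d) ^ d / ∏ i, a x i := by gcongr
    _ = _ := by
        rw [Finset.mul_sum]
        refine Finset.sum_congr rfl fun x _ => ?_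
        rw [div_pow]; field_simp

end MaximumPrinciple

section SetwiseLimit

variable {α : Type*} [MeasurableSpace α]

/-- Measures that are uniformly absolutely continuous with respect to a finite measure converge
setwise along some ultrafilter. -/
theorem exists_measure_tendsto_setwise (m : ℕ → Measure α) (ν : Measure α) [IsFiniteMeasure ν]
    {φ : ℝ≥0∞ → ℝ≥0∞} (hφ : Tendsto φ (𝓝 0) (𝓝 0))
    (hm : ∀ n B, MeasurableSet B → m n B ≤ φ (ν B)) (U : Ultrafilter ℕ) :
    ∃ lam : Measure α, ∀ B, MeasurableSet B → Tendsto (fun n => m n B) U (𝓝 (lam B)) := by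
  let l : Set α → ℝ≥0∞ := fun B => (U.map fun n => m n B).lim
  have hl : ∀ B, Tendsto (fun n => m n B) U (𝓝 (l B)) := fun B =>
    (U.map fun n => m n B).le_nhds_lim
  have hl0 : l ∅ = 0 := tendsto_nhds_unique (hl ∅) (by simp)
  have hadd : ∀ A B, Disjoint A B → MeasurableSet B → l (A ∪ B) = l A + l B := fun A B hAB hB =>
    tendsto_nhds_unique (hl _) (by
      simpa only [measure_union hAB hB] using (hl A).add (hl B))
  have hle : ∀ B, MeasurableSet B → l B ≤ φ (ν B) := fun B hB =>
    le_of_tendsto (hl B) (Eventually.of_forall fun n => hm n B hB)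
  have hsum : ∀ f : ℕ → Set α, (∀ i, MeasurableSet (f i)) → Pairwise (Function.onFun Disjoint f) →
      l (⋃ i, f i) = ∑' i, l (f i) := by
    intro f hf hd
    have hsplit : ∀ n, l (⋃ i, f i) = ∑ i ∈ Finset.range n, l (f i) + l (⋃ i, f (i + n)) := by
      intro n
      induction n with
      | zero => simp
      | succ n ih =>
        have hU : ⋃ i, f (i + n) = f n ∪ ⋃ i, f (i + (n + 1)) := by
          rw [← Set.union_iUnion_nat_succ fun i => f (i + n)]
          simp only [zero_add, add_right_comm, add_assoc]
        rw [ih, Finset.sum_range_succ, hU, hadd _ _ _ (MeasurableSet.iUnion fun i => hf _),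
          add_assoc]
        exact Set.disjoint_iUnion_right.2 fun i => hd (by omega)
    have htail : Tendsto (fun n => ν (⋃ i, f (i + n))) atTop (𝓝 0) := by
      have h := ENNReal.tendsto_sum_nat_add (fun i => ν (f i))
        (by rw [← measure_iUnion hd hf]; exact measure_ne_top _ _)
      refine h.congr fun n => ?_
      exact (measure_iUnion (f := fun i => f (i + n))
        (fun i j hij => hd fun h => hij (Nat.add_right_cancel h)) fun i => hf _).symm
    have htail' : Tendsto (fun n => l (⋃ i, f (i + n))) atTop (𝓝 0) :=
      tendsto_of_tendsto_of_tendsto_of_le_of_le tendsto_const_nhds (hφ.comp htail)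
        (fun _ => zero_le) fun n => hle _ (MeasurableSet.iUnion fun i => hf _)
    have hlim := ENNReal.summable.hasSum.tendsto_sum_nat.add htail'
      (f := fun n => ∑ i ∈ Finset.range n, l (f i))
    simp only [← hsplit, add_zero] at hlim
    exact tendsto_nhds_unique tendsto_const_nhds hlim
  refine ⟨Measure.ofMeasurable (fun B _ => l B) hl0 fun f hf hd => hsum f hf hd, fun B hB => ?_⟩
  rw [Measure.ofMeasurable_apply B hB]
  exact hl B

lemma lintegral_le_of_tendsto_setwise {ι : Type*} {U : Filter ι} [U.NeBot] {m : ι → Measure α}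
    {lam : Measure α} (h : ∀ B, MeasurableSet B → Tendsto (fun n => m n B) U (𝓝 (lam B)))
    {f : α → ℝ≥0∞} (hf : ∀ x, f x ≠ ⊤) {b : ι → ℝ≥0∞} {c : ℝ≥0∞}
    (hb : ∀ᶠ n in U, ∫⁻ x, f x ∂m n ≤ b n) (hbc : Tendsto b U (𝓝 c)) :
    ∫⁻ x, f x ∂lam ≤ c := by
  rw [lintegral]
  refine iSup₂_le fun g hg => ?_
  have hlim : Tendsto (fun n => g.lintegral (m n)) U (𝓝 (g.lintegral lam)) := by
    refine tendsto_finsetSum _ fun y hy => ENNReal.Tendsto.const_mul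
      (h _ (g.measurableSet_fiber y)) (Or.inr ?_)
    obtain ⟨x, rfl⟩ := SimpleFunc.mem_range.1 hy
    exact ((hg x).trans_lt (hf x).lt_top).ne
  refine le_of_tendsto_of_tendsto hlim hbc (hb.mono fun n hn => le_trans ?_ hn)
  rw [lintegral]
  exact le_iSup₂_of_le g hg le_rfl

end SetwiseLimit

section Occupation

variable {d : ℕ}

lemma shiftE_add (x v : Zd d) (ω : Env d) : shiftE v (shiftE x ω) = shiftE (x + v) ω := by
  funext y
  simp [shiftE, add_assoc]

lemma shiftE_zero (ω : Env d) : shiftE 0 ω = ω := by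
  funext y
  simp [shiftE]

lemma measurable_shiftE (x : Zd d) : Measurable (shiftE x : Env d → Env d) :=
  measurable_pi_lambda _ fun _ => measurable_pi_apply _

lemma measurable_weight {E : Sd d → Sd d} (hE : Measurable E) (x v : Zd d) :
    Measurable fun ω : Env d => (E (ω x)).1 v :=
  (measurable_pi_apply v).comp (measurable_subtype_coe.comp (hE.comp (measurable_pi_apply x)))

lemma sum_ofReal_weight (s : Sd d) : ∑ v ∈ Vfin d, ENNReal.ofReal (s.1 v) = 1 := by
  rw [← ENNReal.ofReal_sum_of_nonneg fun v _ => s.2.1 v, s.2.2.2, ENNReal.ofReal_one]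

lemma sum_weight_mul_of_balanced {s : Sd d} (hs : ∀ i, s.1 (eZ d i) = s.1 (-eZ d i))
    (g : Zd d → ℝ) (x : Zd d) :
    ∑ v ∈ Vfin d, s.1 v * g (x + v) =
      g x + ∑ i, s.1 (eZ d i) * (g (x + eZ d i) + g (x - eZ d i) - 2 * g x) := by
  have h1 := s.2.2.2
  rw [sum_Vfin] at h1 ⊢
  simp only [← hs, add_zero, ← sub_eq_add_neg] at h1 ⊢
  have h2 : s.1 0 = 1 - ∑ i, (s.1 (eZ d i) + s.1 (eZ d i)) := by linarith
  rw [h2, sub_mul, one_mul, Finset.sum_mul, add_comm, sub_add_eq_add_sub, add_sub_assoc,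
    ← Finset.sum_sub_distrib]
  exact congrArg _ (Finset.sum_congr rfl fun i _ => by ring)

lemma two_mul_sum_weight_le_one {s : Sd d} (hs : ∀ i, s.1 (eZ d i) = s.1 (-eZ d i)) :
    ∑ i, s.1 (eZ d i) * 2 ≤ 1 := by
  have h1 := s.2.2.2
  rw [sum_Vfin] at h1
  simp only [← hs, ← mul_two] at h1
  linarith [s.2.1 0]

lemma measurable_Kker {E : Sd d → Sd d} (hE : Measurable E) {B : Set (Env d)}
    (hB : MeasurableSet B) : Measurable fun ω => Kker d E ω B :=
  Finset.measurable_sum _ fun v _ => (measurable_weight hE 0 v).ennreal_ofReal.mul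
    ((measurable_const.indicator hB).comp (measurable_shiftE v))

lemma Kker_shiftE (E : Sd d → Sd d) (ω : Env d) (x : Zd d) (B : Set (Env d)) :
    Kker d E (shiftE x ω) B = ∑ v ∈ Vfin d, ENNReal.ofReal ((E (ω x)).1 v) *
      B.indicator (fun _ => (1 : ℝ≥0∞)) (shiftE (x + v) ω) := by
  simp only [Kker, shiftE_add]
  simp [shiftE]

lemma Kker_add_compl (E : Sd d → Sd d) (ω : Env d) (B : Set (Env d)) :
    Kker d E ω B + Kker d E ω Bᶜ = 1 := by
  rw [Kker, Kker, ← Finset.sum_add_distrib]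
  refine (Finset.sum_congr rfl fun v _ => ?_).trans (sum_ofReal_weight (E (ω 0)))
  rw [← mul_add, Set.indicator_self_add_compl_apply, mul_one]

lemma Kker_ne_top (E : Sd d → Sd d) (ω : Env d) (B : Set (Env d)) : Kker d E ω B ≠ ⊤ :=
  ne_top_of_le_ne_top ENNReal.one_ne_top (le_self_add.trans_eq (Kker_add_compl E ω B))

/-- The expected occupation measure of the environment process over the first `n` steps of the
walk in `ω` started at `x` and killed on leaving `Q`. -/
def occupation (E : Sd d → Sd d) (Q : Finset (Zd d)) (ω : Env d) : ℕ → Zd d → Measure (Env d)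
  | 0, _ => 0
  | n + 1, x =>
    if x ∈ Q then
      Measure.dirac (shiftE x ω) +
        ∑ v ∈ Vfin d, ENNReal.ofReal ((E (ω x)).1 v) • occupation E Q ω n (x + v)
    else 0

variable {E : Sd d → Sd d} {Q : Finset (Zd d)} {ω : Env d}

lemma lintegral_occupation_succ {F : Env d → ℝ≥0∞} (hF : Measurable F) (n : ℕ) (x : Zd d) :
    ∫⁻ η, F η ∂occupation E Q ω (n + 1) x =
      if x ∈ Q then F (shiftE x ω) + ∑ v ∈ Vfin d, ENNReal.ofReal ((E (ω x)).1 v) *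
        ∫⁻ η, F η ∂occupation E Q ω n (x + v) else 0 := by
  rw [occupation]
  split_ifs
  · rw [lintegral_add_measure, lintegral_dirac' _ hF, lintegral_finsetSum_measure]
    simp only [lintegral_smul_measure, smul_eq_mul]
  · simp

lemma occupation_succ_apply {B : Set (Env d)} (hB : MeasurableSet B) (n : ℕ) (x : Zd d) :
    occupation E Q ω (n + 1) x B =
      if x ∈ Q then B.indicator (fun _ => 1) (shiftE x ω) +
        ∑ v ∈ Vfin d, ENNReal.ofReal ((E (ω x)).1 v) * occupation E Q ω n (x + v) B else 0 := by
  simpa only [lintegral_indicator hB, lintegral_one, Measure.restrict_apply_univ] using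
    lintegral_occupation_succ (E := E) (Q := Q) (ω := ω)
      (measurable_const.indicator hB : Measurable (B.indicator fun _ => (1 : ℝ≥0∞))) n x

lemma occupation_eq_zero_of_notMem {x : Zd d} (hx : x ∉ Q) (n : ℕ) :
    occupation E Q ω n x = 0 := by
  cases n <;> simp [occupation, hx]

lemma occupation_univ_le (n : ℕ) (x : Zd d) : occupation E Q ω n x Set.univ ≤ n := by
  induction n generalizing x with
  | zero => simp [occupation]
  | succ n ih =>
    rw [occupation_succ_apply MeasurableSet.univ]
    split_ifs
    · calc _ ≤ 1 + ∑ v ∈ Vfin d, ENNReal.ofReal ((E (ω x)).1 v) * n := by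
            gcongr
            · simp
            · exact ih _
        _ = _ := by rw [← Finset.sum_mul, sum_ofReal_weight]; push_cast; ring
    · exact zero_le

instance (n : ℕ) (x : Zd d) : IsFiniteMeasure (occupation E Q ω n x) :=
  ⟨(occupation_univ_le n x).trans_lt (ENNReal.natCast_lt_top n)⟩

lemma occupation_apply_le_succ {B : Set (Env d)} (hB : MeasurableSet B) (n : ℕ) (x : Zd d) :
    occupation E Q ω n x B ≤ occupation E Q ω (n + 1) x B := by
  induction n generalizing x with
  | zero => simp [occupation]
  | succ n ih =>
    rw [occupation_succ_apply hB, occupation_succ_apply hB]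
    split_ifs
    · exact add_le_add le_rfl (Finset.sum_le_sum fun v _ => mul_le_mul' le_rfl (ih _))
    · exact le_rfl

lemma measurable_occupation (hE : Measurable E) (n : ℕ) (x : Zd d) :
    Measurable fun ω => occupation E Q ω n x := by
  refine Measure.measurable_of_measurable_coe _ fun B hB => ?_
  induction n generalizing x with
  | zero => simp [occupation]
  | succ n ih =>
    simp only [occupation_succ_apply hB]
    by_cases hx : x ∈ Q
    · simp only [hx, if_true]
      exact ((measurable_const.indicator hB).comp (measurable_shiftE x)).add
        (Finset.measurable_sum _ fun v _ => (measurable_weight hE x v).ennreal_ofReal.mul (ih _))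
    · simp [hx]

lemma lintegral_Kker_occupation_add_le (hE : Measurable E) {B : Set (Env d)}
    (hB : MeasurableSet B) (n : ℕ) (x : Zd d) :
    ∫⁻ η, Kker d E η B ∂occupation E Q ω n x + B.indicator (fun _ => 1) (shiftE x ω) ≤
      1 + occupation E Q ω n x B := by
  have hind : ∀ η, B.indicator (fun _ => (1 : ℝ≥0∞)) η ≤ 1 := fun η =>
    Set.indicator_le_self' (fun _ _ => zero_le) η
  induction n generalizing x with
  | zero => simpa [occupation] using hind _
  | succ n ih =>
    rw [lintegral_occupation_succ (measurable_Kker hE hB), occupation_succ_apply hB]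
    split_ifs
    · rw [Kker_shiftE, ← Finset.sum_add_distrib]
      calc _ = ∑ v ∈ Vfin d, ENNReal.ofReal ((E (ω x)).1 v) *
              (∫⁻ η, Kker d E η B ∂occupation E Q ω n (x + v) +
                B.indicator (fun _ => 1) (shiftE (x + v) ω)) +
              B.indicator (fun _ => 1) (shiftE x ω) := by
            congr 1
            exact Finset.sum_congr rfl fun v _ => by rw [mul_add, add_comm]
        _ ≤ ∑ v ∈ Vfin d, ENNReal.ofReal ((E (ω x)).1 v) *
              (1 + occupation E Q ω n (x + v) B) + B.indicator (fun _ => 1) (shiftE x ω) := by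
            exact add_le_add (Finset.sum_le_sum fun v _ => mul_le_mul' le_rfl (ih _)) le_rfl
        _ = _ := by
            simp only [mul_add, mul_one, Finset.sum_add_distrib, sum_ofReal_weight]
            ring
    · simpa using hind _

lemma toReal_occupation_succ_of_mem {B : Set (Env d)} (hB : MeasurableSet B) (n : ℕ) {x : Zd d}
    (hx : x ∈ Q) :
    (occupation E Q ω (n + 1) x).real B = B.indicator (fun _ => 1) (shiftE x ω) +
      ∑ v ∈ Vfin d, (E (ω x)).1 v * (occupation E Q ω n (x + v)).real B := by
  have hne : ∀ v ∈ Vfin d, ENNReal.ofReal ((E (ω x)).1 v) * occupation E Q ω n (x + v) B ≠ ⊤ :=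
    fun v _ => ENNReal.mul_ne_top ENNReal.ofReal_ne_top (measure_ne_top _ _)
  have hind : (B.indicator (fun _ => (1 : ℝ≥0∞)) (shiftE x ω)).toReal =
      B.indicator (fun _ => (1 : ℝ)) (shiftE x ω) := by
    by_cases h : shiftE x ω ∈ B <;> simp [h]
  rw [Measure.real, occupation_succ_apply hB, if_pos hx, ENNReal.toReal_add _
    (ENNReal.sum_ne_top.2 hne), ENNReal.toReal_sum hne, hind]
  · simp only [ENNReal.toReal_mul, ENNReal.toReal_ofReal ((E (ω x)).2.1 _), Measure.real]
  · by_cases h : shiftE x ω ∈ B <;> simp [h]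

lemma le_occupation_univ {L : ℕ} (hL : 0 < L)
    (hbal : ∀ (s : Sd d) i, (E s).1 (eZ d i) = (E s).1 (-eZ d i)) (n : ℕ) (x : Zd d) :
    (n : ℝ) - n * (n - 1) / (2 * L ^ 2) - n * (∑ i, (x i : ℝ) ^ 2) / L ^ 2 ≤
      (occupation E (cube d L) ω n x).real Set.univ := by
  have hL2 : (0 : ℝ) < (L : ℝ) ^ 2 := by positivity
  induction n generalizing x with
  | zero => simp
  | succ n ih =>
    by_cases hx : x ∈ cube d L
    · rw [toReal_occupation_succ_of_mem MeasurableSet.univ n hx]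
      set g : Zd d → ℝ := fun y =>
        (n : ℝ) - n * (n - 1) / (2 * L ^ 2) - n * (∑ i, (y i : ℝ) ^ 2) / L ^ 2 with hg
      have h1 : ∑ v ∈ Vfin d, (E (ω x)).1 v * g (x + v) ≤
          ∑ v ∈ Vfin d, (E (ω x)).1 v * (occupation E (cube d L) ω n (x + v)).real Set.univ :=
        Finset.sum_le_sum fun v _ => mul_le_mul_of_nonneg_left (ih _) ((E (ω x)).2.1 v)
      rw [sum_weight_mul_of_balanced (hbal _)] at h1
      have h2 : ∀ i, g (x + eZ d i) + g (x - eZ d i) - 2 * g x = - (n / L ^ 2 * 2) := by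
        intro i
        have hs : ∑ j, ((x + eZ d i) j : ℝ) ^ 2 + ∑ j, ((x - eZ d i) j : ℝ) ^ 2 =
            2 * ∑ j, (x j : ℝ) ^ 2 + 2 := by
          have he : ∑ j, (eZ d i j : ℝ) ^ 2 = 1 := by
            simp [eZ, Pi.single_apply]
          rw [← Finset.sum_add_distrib]
          calc _ = ∑ j, (2 * (x j : ℝ) ^ 2 + 2 * (eZ d i j : ℝ) ^ 2) :=
                Finset.sum_congr rfl fun j _ => by
                  simp only [Pi.add_apply, Pi.sub_apply]; push_cast; ring
            _ = _ := by rw [Finset.sum_add_distrib, ← Finset.mul_sum, ← Finset.mul_sum, he, mul_one]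
        simp only [hg]
        rw [eq_sub_of_add_eq hs]
        ring
      simp only [h2] at h1
      have h3 : ∑ i, (E (ω x)).1 (eZ d i) * -((n : ℝ) / L ^ 2 * 2) ≥ -((n : ℝ) / L ^ 2) := by
        have := mul_le_mul_of_nonneg_left (two_mul_sum_weight_le_one (hbal (ω x)))
          (by positivity : (0 : ℝ) ≤ n / L ^ 2)
        rw [Finset.mul_sum] at this
        have h4 : ∑ i, (E (ω x)).1 (eZ d i) * -((n : ℝ) / L ^ 2 * 2) =
            -∑ i, (n : ℝ) / L ^ 2 * ((E (ω x)).1 (eZ d i) * 2) := by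
          rw [← Finset.sum_neg_distrib]
          exact Finset.sum_congr rfl fun i _ => by ring
        linarith
      have h5 : 0 ≤ (∑ i, (x i : ℝ) ^ 2) / L ^ 2 :=
        div_nonneg (Finset.sum_nonneg fun _ _ => sq_nonneg _) hL2.le
      have h6 : ((n + 1 : ℕ) : ℝ) - (n + 1 : ℕ) * ((n + 1 : ℕ) - 1) / (2 * L ^ 2) -
          (n + 1 : ℕ) * (∑ i, (x i : ℝ) ^ 2) / L ^ 2 =
          1 + g x - n / L ^ 2 - (∑ i, (x i : ℝ) ^ 2) / L ^ 2 := by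
        simp only [hg]; push_cast; field_simp; ring
      rw [h6]
      simp only [Set.indicator_univ]
      linarith
    · rw [occupation_eq_zero_of_notMem hx]
      simp only [measureReal_zero_apply]
      have h1 := sq_le_sum_sq_of_notMem_cube hx
      have h2 : ((n + 1 : ℕ) : ℝ) ≤ (n + 1 : ℕ) * (∑ i, (x i : ℝ) ^ 2) / L ^ 2 := by
        rw [le_div_iff₀ hL2]
        gcongr
      have h3 : (0 : ℝ) ≤ (n + 1 : ℕ) * ((n + 1 : ℕ) - 1) / (2 * L ^ 2) := by
        push_cast
        rw [add_sub_cancel_right]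
        positivity
      linarith

end Occupation

section DensityBound

variable {d : ℕ} {E : Sd d → Sd d} {ω : Env d}

/-- The reciprocal of the product of the jump probabilities `ℰ(ω)(0, e_i)`. -/
def abpWeight (E : Sd d → Sd d) (ω : Env d) : ℝ≥0∞ :=
  ENNReal.ofReal (1 / ∏ i, (E (ω 0)).1 (eZ d i))

lemma measurable_abpWeight (hE : Measurable E) : Measurable (abpWeight E) :=
  (measurable_const.div
    (Finset.measurable_prod _ fun i _ => measurable_weight hE 0 (eZ d i))).ennreal_ofReal

lemma pow_occupation_le (hd : 0 < d) {L : ℕ} (hL : 0 < L)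
    (hbal : ∀ (s : Sd d) i, (E s).1 (eZ d i) = (E s).1 (-eZ d i))
    (hell : ∀ x : Zd d, ∀ v ∈ Vfin d, v ≠ 0 → 0 < (E (ω x)).1 v)
    {B : Set (Env d)} (hB : MeasurableSet B) (n : ℕ) :
    occupation E (cube d L) ω n 0 B ^ d ≤ ENNReal.ofReal ((L / 2) ^ d) *
      ∑ x ∈ cube d L, B.indicator (abpWeight E) (shiftE x ω) := by
  have hL' : (0 : ℝ) < L := by exact_mod_cast hL
  set u : Zd d → ℝ := fun x => (occupation E (cube d L) ω n x).real B with hu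
  have ha : ∀ x i, 0 < (E (ω x)).1 (eZ d i) := fun x i =>
    hell x _ (eZ_mem_Vfin i) (eZ_ne_zero i)
  have hA : ∀ x, 0 < ∏ i, (E (ω x)).1 (eZ d i) := fun x => Finset.prod_pos fun i _ => ha x i
  have hf : ∀ x, 0 ≤ B.indicator (fun _ => (1 : ℝ)) (shiftE x ω) := fun x =>
    Set.indicator_nonneg (fun _ _ => zero_le_one) _
  have habp := discrete_abp hd hL (u := u) (f := fun x => B.indicator (fun _ => 1) (shiftE x ω))
    (a := fun x i => (E (ω x)).1 (eZ d i))
    (fun x hx => by simp [hu, occupation_eq_zero_of_notMem hx]) measureReal_nonneg hf ha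
    (fun x hx => by
      have h1 : u x ≤ (occupation E (cube d L) ω (n + 1) x).real B :=
        ENNReal.toReal_mono (measure_ne_top _ _) (occupation_apply_le_succ hB n x)
      rw [toReal_occupation_succ_of_mem hB n hx, sum_weight_mul_of_balanced (hbal _) u] at h1
      have h2 : ∑ i, (E (ω x)).1 (eZ d i) * (2 * u x - u (x + eZ d i) - u (x - eZ d i)) =
          -∑ i, (E (ω x)).1 (eZ d i) * (u (x + eZ d i) + u (x - eZ d i) - 2 * u x) := by
        rw [← Finset.sum_neg_distrib]
        exact Finset.sum_congr rfl fun i _ => by ring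
      rw [h2]
      linarith)
  have hsum : ∑ x ∈ cube d L, B.indicator (abpWeight E) (shiftE x ω) =
      ENNReal.ofReal (∑ x ∈ cube d L, B.indicator (fun _ => (1 : ℝ)) (shiftE x ω) ^ d /
        ∏ i, (E (ω x)).1 (eZ d i)) := by
    rw [ENNReal.ofReal_sum_of_nonneg fun x _ => div_nonneg (pow_nonneg (hf x) _) (hA x).le]
    refine Finset.sum_congr rfl fun x _ => ?_
    by_cases h : shiftE x ω ∈ B
    · simp only [Set.indicator_of_mem h, one_pow, abpWeight, shiftE, add_zero]
    · simp only [Set.indicator_of_notMem h, zero_pow hd.ne', zero_div, ENNReal.ofReal_zero]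
  rw [hsum, ← ENNReal.ofReal_mul (by positivity),
    ← ENNReal.ofReal_toReal (measure_ne_top (occupation E (cube d L) ω n 0) B),
    ← ENNReal.ofReal_pow ENNReal.toReal_nonneg]
  refine ENNReal.ofReal_le_ofReal ?_
  calc u 0 ^ d = (L / 2 : ℝ) ^ d * (2 * u 0 / L) ^ d := by
        rw [← mul_pow]; congr 1; field_simp
    _ ≤ _ := by gcongr

variable {μ : Measure (Env d)}

lemma lintegral_pow_occupation_le (hd : 0 < d) {L : ℕ} (hL : 0 < L)
    (hμ : ∀ x : Zd d, Measure.map (shiftE x) μ = μ) (hE : Measurable E)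
    (hbal : ∀ (s : Sd d) i, (E s).1 (eZ d i) = (E s).1 (-eZ d i))
    (hell : ∀ᵐ ω ∂μ, ∀ x : Zd d, ∀ v ∈ Vfin d, v ≠ 0 → 0 < (E (ω x)).1 v)
    {B : Set (Env d)} (hB : MeasurableSet B) (n : ℕ) :
    ∫⁻ ω, occupation E (cube d L) ω n 0 B ^ d ∂μ ≤
      ((L : ℝ≥0∞) ^ 2) ^ d * μ.withDensity (abpWeight E) B := by
  have hW : Measurable (B.indicator (abpWeight E)) := (measurable_abpWeight hE).indicator hB
  have hWx : ∀ x : Zd d, Measurable fun ω => B.indicator (abpWeight E) (shiftE x ω) := fun x =>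
    hW.comp (measurable_shiftE x)
  calc ∫⁻ ω, occupation E (cube d L) ω n 0 B ^ d ∂μ
      ≤ ∫⁻ ω, ENNReal.ofReal ((L / 2) ^ d) *
          ∑ x ∈ cube d L, B.indicator (abpWeight E) (shiftE x ω) ∂μ :=
        lintegral_mono_ae (hell.mono fun ω h => pow_occupation_le hd hL hbal h hB n)
    _ = ENNReal.ofReal ((L / 2) ^ d) *
          ((cube d L).card * μ.withDensity (abpWeight E) B) := by
        rw [lintegral_const_mul _ (Finset.measurable_sum _ fun x _ => hWx x),
          lintegral_finsetSum _ fun x _ => hWx x]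
        have h : ∀ x : Zd d, ∫⁻ ω, B.indicator (abpWeight E) (shiftE x ω) ∂μ =
            μ.withDensity (abpWeight E) B := fun x => by
          rw [← lintegral_map hW (measurable_shiftE x), hμ x, lintegral_indicator hB,
            withDensity_apply _ hB]
        simp only [h, Finset.sum_const, nsmul_eq_mul]
    _ ≤ ENNReal.ofReal ((L / 2) ^ d) *
          (ENNReal.ofReal ((2 * L) ^ d) * μ.withDensity (abpWeight E) B) := by
        gcongr
        rw [← ENNReal.ofReal_natCast]
        exact ENNReal.ofReal_le_ofReal (by exact_mod_cast card_cube_le d L)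
    _ = _ := by
        rw [← mul_assoc, ← ENNReal.ofReal_mul (by positivity), ← mul_pow,
          show (L / 2 : ℝ) * (2 * L) = L ^ 2 by ring, ENNReal.ofReal_pow (by positivity),
          ENNReal.ofReal_pow (by positivity), ENNReal.ofReal_natCast]

lemma lintegral_le_rpow_lintegral_pow [IsProbabilityMeasure μ] (hd : 0 < d)
    {f : Env d → ℝ≥0∞} (hf : Measurable f) :
    ∫⁻ ω, f ω ∂μ ≤ (∫⁻ ω, f ω ^ d ∂μ) ^ (d : ℝ)⁻¹ := by
  have h := eLpNorm'_le_eLpNorm'_of_exponent_le (p := 1) (q := d) zero_lt_one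
    (by exact_mod_cast hd) μ hf.aestronglyMeasurable
  simpa [eLpNorm'] using h

lemma withDensity_abpWeight_univ_lt_top {p : ℝ} (hp : (d : ℝ) < p)
    (hd : 0 < d) (hbal : ∀ (s : Sd d) i, (E s).1 (eZ d i) = (E s).1 (-eZ d i))
    (hell : ∀ᵐ ω ∂μ, ∀ x : Zd d, ∀ v ∈ Vfin d, v ≠ 0 → 0 < (E (ω x)).1 v)
    (hmom : ∫⁻ ω, ENNReal.ofReal (cE d E ω 0 ^ (-p)) ∂μ < ⊤) :
    μ.withDensity (abpWeight E) Set.univ < ⊤ := by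
  have hd' : (d : ℝ) ≠ 0 := by exact_mod_cast hd.ne'
  rw [withDensity_apply _ MeasurableSet.univ, Measure.restrict_univ]
  refine lt_of_le_of_lt (lintegral_mono_ae (hell.mono fun ω h => ?_)) hmom
  refine ENNReal.ofReal_le_ofReal ?_
  have ha : ∀ i, 0 < (E (ω 0)).1 (eZ d i) := fun i => h 0 _ (eZ_mem_Vfin i) (eZ_ne_zero i)
  have hA : 0 < ∏ i, (E (ω 0)).1 (eZ d i) := Finset.prod_pos fun i _ => ha i
  have hA1 : ∏ i, (E (ω 0)).1 (eZ d i) ≤ 1 := by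
    refine Finset.prod_le_one (fun i _ => (ha i).le) fun i _ => ?_
    rw [← (E (ω 0)).2.2.2]
    exact Finset.single_le_sum (fun v _ => (E (ω 0)).2.1 v) (eZ_mem_Vfin i)
  have hc : cE d E ω 0 = (∏ i, (E (ω 0)).1 (eZ d i)) ^ (d : ℝ)⁻¹ := by
    rw [cE, prod_Vfin_erase]
    simp only [← hbal, ← sq]
    rw [Finset.prod_pow, ← Real.rpow_natCast, ← Real.rpow_mul hA.le]
    congr 1
    push_cast
    field_simp
  calc 1 / ∏ i, (E (ω 0)).1 (eZ d i) = cE d E ω 0 ^ (-(d : ℝ)) := by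
        rw [hc, ← Real.rpow_mul hA.le, mul_neg, inv_mul_cancel₀ hd', Real.rpow_neg_one, one_div]
    _ ≤ cE d E ω 0 ^ (-p) := by
        rw [hc]
        exact Real.rpow_le_rpow_of_exponent_ge (Real.rpow_pos_of_pos hA _)
          (Real.rpow_le_one hA.le hA1 (by positivity)) (by linarith)

/-- The expected occupation measure, averaged over the environment and normalised by the time
horizon `L ^ 2`. -/
def meanOccupation (E : Sd d → Sd d) (μ : Measure (Env d)) (L : ℕ) : Measure (Env d) :=
  ((L : ℝ≥0∞) ^ 2)⁻¹ • μ.bind fun ω => occupation E (cube d L) ω (L ^ 2) 0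

lemma meanOccupation_apply (hE : Measurable E) (L : ℕ) {B : Set (Env d)} (hB : MeasurableSet B) :
    meanOccupation E μ L B =
      ((L : ℝ≥0∞) ^ 2)⁻¹ * ∫⁻ ω, occupation E (cube d L) ω (L ^ 2) 0 B ∂μ := by
  rw [meanOccupation, Measure.smul_apply, Measure.bind_apply hB
    (measurable_occupation hE _ _).aemeasurable, smul_eq_mul]

lemma meanOccupation_le [IsProbabilityMeasure μ] (hd : 0 < d) {L : ℕ} (hL : 0 < L)
    (hμ : ∀ x : Zd d, Measure.map (shiftE x) μ = μ) (hE : Measurable E)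
    (hbal : ∀ (s : Sd d) i, (E s).1 (eZ d i) = (E s).1 (-eZ d i))
    (hell : ∀ᵐ ω ∂μ, ∀ x : Zd d, ∀ v ∈ Vfin d, v ≠ 0 → 0 < (E (ω x)).1 v)
    {B : Set (Env d)} (hB : MeasurableSet B) :
    meanOccupation E μ L B ≤ μ.withDensity (abpWeight E) B ^ (d : ℝ)⁻¹ := by
  rw [meanOccupation_apply hE L hB]
  calc _ ≤ ((L : ℝ≥0∞) ^ 2)⁻¹ *
        (((L : ℝ≥0∞) ^ 2) ^ d * μ.withDensity (abpWeight E) B) ^ (d : ℝ)⁻¹ := by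
        gcongr
        refine (lintegral_le_rpow_lintegral_pow hd ((Measure.measurable_coe hB).comp
          (measurable_occupation hE _ _))).trans ?_
        gcongr
        exact lintegral_pow_occupation_le hd hL hμ hE hbal hell hB _
    _ = _ := by
        rw [ENNReal.mul_rpow_of_nonneg _ _ (by positivity), ← mul_assoc,
          ENNReal.pow_rpow_inv_natCast hd.ne', ENNReal.inv_mul_cancel, one_mul]
        · simpa using hL.ne'
        · finiteness

lemma half_le_meanOccupation_univ [IsProbabilityMeasure μ] {L : ℕ} (hL : 0 < L)
    (hE : Measurable E) (hbal : ∀ (s : Sd d) i, (E s).1 (eZ d i) = (E s).1 (-eZ d i)) :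
    2⁻¹ ≤ meanOccupation E μ L Set.univ := by
  have hL' : (0 : ℝ) < L := by exact_mod_cast hL
  have hω : ∀ ω : Env d, ((L : ℝ≥0∞) ^ 2) * 2⁻¹ ≤
      occupation E (cube d L) ω (L ^ 2) 0 Set.univ := by
    intro ω
    rw [← ENNReal.ofReal_toReal (measure_ne_top (occupation E (cube d L) ω (L ^ 2) 0) Set.univ),
      show (L : ℝ≥0∞) ^ 2 * 2⁻¹ = ENNReal.ofReal (L ^ 2 * 2⁻¹) by
        rw [ENNReal.ofReal_mul (by positivity), ENNReal.ofReal_pow hL'.le, ENNReal.ofReal_natCast,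
          ENNReal.ofReal_inv_of_pos two_pos, ENNReal.ofReal_ofNat]]
    refine ENNReal.ofReal_le_ofReal (le_trans ?_ (le_occupation_univ hL hbal (L ^ 2) 0))
    simp only [Pi.zero_apply, Int.cast_zero, ne_eq, OfNat.ofNat_ne_zero, not_false_eq_true,
      zero_pow, Finset.sum_const_zero, mul_zero, zero_div, sub_zero]
    push_cast
    rw [mul_comm (2 : ℝ), mul_div_mul_left _ _ (by positivity)]
    linarith
  rw [meanOccupation_apply hE L MeasurableSet.univ]
  calc (2⁻¹ : ℝ≥0∞) = ((L : ℝ≥0∞) ^ 2)⁻¹ * ∫⁻ _ω, ((L : ℝ≥0∞) ^ 2) * 2⁻¹ ∂μ := by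
        rw [lintegral_const, measure_univ, mul_one, ← mul_assoc, ENNReal.inv_mul_cancel, one_mul]
        · simpa using hL.ne'
        · finiteness
    _ ≤ _ := by
        gcongr
        exact hω _

lemma lintegral_Kker_meanOccupation_le [IsProbabilityMeasure μ] (hE : Measurable E) {L : ℕ}
    {B : Set (Env d)} (hB : MeasurableSet B) :
    ∫⁻ ω, Kker d E ω B ∂meanOccupation E μ L ≤
      ((L : ℝ≥0∞) ^ 2)⁻¹ + meanOccupation E μ L B := by
  rw [meanOccupation_apply hE L hB, meanOccupation, lintegral_smul_measure, smul_eq_mul,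
    Measure.lintegral_bind (measurable_occupation hE _ _).aemeasurable
      (measurable_Kker hE hB).aemeasurable]
  calc _ ≤ ((L : ℝ≥0∞) ^ 2)⁻¹ * ∫⁻ ω, 1 + occupation E (cube d L) ω (L ^ 2) 0 B ∂μ := by
        gcongr
        exact le_self_add.trans (lintegral_Kker_occupation_add_le hE hB _ _)
    _ = _ := by
        rw [lintegral_add_left measurable_const, lintegral_const, measure_univ, mul_one, mul_add,
          mul_one]

end DensityBound

section Ergodicity

variable {d : ℕ} {μ : Measure (Env d)} {E : Sd d → Sd d}

lemma measure_eq_zero_or_one_of_forall_ae_eq (hμ : StationaryErgodic μ) {B : Set (Env d)}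
    (hB : MeasurableSet B) (h : ∀ x : Zd d, shiftE x ⁻¹' B =ᵐ[μ] B) : μ B = 0 ∨ μ B = 1 := by
  have hI : (⋂ x : Zd d, shiftE x ⁻¹' B) =ᵐ[μ] B := by
    simpa only [Set.iInter_const] using Filter.EventuallyEq.countable_iInter h
  rw [← measure_congr hI]
  refine hμ.2 _ (MeasurableSet.iInter fun x => measurable_shiftE x hB) fun y => ?_
  ext ω
  simp only [Set.mem_preimage, Set.mem_iInter, shiftE_add]
  exact (Equiv.addLeft y).forall_congr_right (q := fun x => shiftE x ω ∈ B)

/-- A set which almost every point cannot leave by a single lattice step is trivial. -/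
lemma measure_eq_zero_or_one_of_ae_shift_mem [IsProbabilityMeasure μ] (hμ : StationaryErgodic μ)
    {B : Set (Env d)} (hB : MeasurableSet B)
    (h : ∀ᵐ ω ∂μ, ω ∈ B → ∀ v ∈ Vfin d, v ≠ 0 → shiftE v ω ∈ B) : μ B = 0 ∨ μ B = 1 := by
  have hmp : ∀ x : Zd d, MeasurePreserving (shiftE x) μ μ := fun x =>
    ⟨measurable_shiftE x, hμ.1 x⟩
  let S : AddSubgroup (Zd d) :=
    { carrier := {x | shiftE x ⁻¹' B =ᵐ[μ] B}
      zero_mem' := by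
        simp only [Set.mem_ofPred_eq, Set.preimage, shiftE_zero, Set.ofPred_mem_eq]
        exact Filter.EventuallyEq.rfl
      add_mem' := fun {x y} hx hy => by
        have h1 := (hmp x).quasiMeasurePreserving.preimage_ae_eq hy
        have h2 : shiftE x ⁻¹' (shiftE y ⁻¹' B) = shiftE (x + y) ⁻¹' B := by
          ext ω; simp only [Set.mem_preimage, shiftE_add]
        rw [h2] at h1
        exact h1.trans hx
      neg_mem' := fun {x} hx => by
        have h1 := (hmp (-x)).quasiMeasurePreserving.preimage_ae_eq hx
        have h2 : shiftE (-x) ⁻¹' (shiftE x ⁻¹' B) = B := by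
          ext ω
          simp only [Set.mem_preimage, shiftE_add, neg_add_cancel, shiftE_zero]
        rw [h2] at h1
        exact h1.symm }
  have he : ∀ i, eZ d i ∈ S := fun i => by
    have hsub : B ≤ᵐ[μ] shiftE (eZ d i) ⁻¹' B := by
      filter_upwards [h] with ω hω hωB
      exact hω hωB _ (eZ_mem_Vfin i) (eZ_ne_zero i)
    exact (ae_eq_of_ae_subset_of_measure_ge hsub
      ((hmp _).measure_preimage hB.nullMeasurableSet).le hB.nullMeasurableSet
      (measure_ne_top _ _)).symm
  refine measure_eq_zero_or_one_of_forall_ae_eq hμ hB fun x => ?_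
  have hx : x = ∑ i, x i • eZ d i := by
    funext j
    simp [eZ, Finset.sum_apply, Pi.single_apply]
  have : x ∈ S := by
    rw [hx]
    exact S.sum_mem fun i _ => S.zsmul_mem (he i) _
  exact this

lemma shiftE_mem_of_Kker_compl_eq_zero {ω : Env d} {B : Set (Env d)}
    (hell : ∀ v ∈ Vfin d, v ≠ 0 → 0 < (E (ω 0)).1 v) (h : Kker d E ω Bᶜ = 0) :
    ∀ v ∈ Vfin d, v ≠ 0 → shiftE v ω ∈ B := by
  intro v hv hv0
  by_contra hvB
  have := Finset.sum_eq_zero_iff.1 h v hv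
  rw [Set.indicator_of_mem (show shiftE v ω ∈ Bᶜ from hvB), mul_one, ENNReal.ofReal_eq_zero] at this
  exact (hell v hv hv0).not_ge this

lemma absolutelyContinuous_of_invariant [IsProbabilityMeasure μ] (hμ : StationaryErgodic μ)
    (hE : Measurable E)
    (hell : ∀ᵐ ω ∂μ, ∀ x : Zd d, ∀ v ∈ Vfin d, v ≠ 0 → 0 < (E (ω x)).1 v)
    {lam : Measure (Env d)} [IsProbabilityMeasure lam] (hac : lam ≪ μ)
    (hinv : ∀ B : Set (Env d), MeasurableSet B → ∫⁻ ω, Kker d E ω B ∂lam = lam B) : μ ≪ lam := by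
  set f := lam.rnDeriv μ
  have hf : Measurable f := Measure.measurable_rnDeriv _ _
  have hlam : μ.withDensity f = lam := Measure.withDensity_rnDeriv_eq _ _ hac
  set B : Set (Env d) := {ω | f ω ≠ 0}
  have hB : MeasurableSet B := hf (measurableSet_singleton 0).compl
  have hBc : lam Bᶜ = 0 := by
    rw [← mem_ae_iff, ← hlam]
    exact (ae_withDensity_iff hf).2 (Eventually.of_forall fun ω h => h)
  have hK : ∀ᵐ ω ∂lam, Kker d E ω Bᶜ = 0 :=
    (lintegral_eq_zero_iff (measurable_Kker hE hB.compl)).1 (by rw [hinv _ hB.compl, hBc])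
  rw [← hlam, ae_withDensity_iff hf] at hK
  rcases measure_eq_zero_or_one_of_ae_shift_mem hμ hB (by
    filter_upwards [hK, hell] with ω h1 h2 hωB
    exact shiftE_mem_of_Kker_compl_eq_zero (h2 0) (h1 hωB)) with h0 | h1
  · have := hac h0
    have h2 : lam Set.univ = 0 := by
      rw [← Set.union_compl_self B]
      exact measure_union_null this hBc
    simp at h2
  · rw [← hlam]
    refine withDensity_absolutelyContinuous' hf.aemeasurable ?_
    exact (prob_compl_eq_zero_iff hB).2 h1

end Ergodicity

theorem stmt0 (d : ℕ) (hd : 1 ≤ d) (μ : Measure (Env d)) [IsProbabilityMeasure μ]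
    (hμ : StationaryErgodic μ)
    (E : Sd d → Sd d) (hE : Measurable E)
    (hbal : ∀ (ω : Env d) (x : Zd d) (i : Fin d),
      (E (ω x)).1 (eZ d i) = (E (ω x)).1 (-eZ d i))
    (hell : ∀ᵐ ω ∂μ, ∀ x : Zd d, ∀ v ∈ Vfin d, v ≠ 0 → 0 < (E (ω x)).1 v)
    (hmom : ∃ p : ℝ, (d : ℝ) < p ∧ ∫⁻ ω, ENNReal.ofReal (cE d E ω 0 ^ (-p)) ∂μ < ⊤) :
    ∃ lam : Measure (Env d), IsProbabilityMeasure lam ∧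
      lam ≪ μ ∧ μ ≪ lam ∧
      (∀ B : Set (Env d), MeasurableSet B → ∫⁻ ω, Kker d E ω B ∂lam = lam B) ∧
      (∀ B : Set (Env d), MeasurableSet B →
        (∀ᵐ ω ∂lam, Kker d E ω B = B.indicator (fun _ => (1 : ℝ≥0∞)) ω) →
        lam B = 0 ∨ lam B = 1) := by
  have hd0 : 0 < d := hd
  have hdinv : (0 : ℝ) < (d : ℝ)⁻¹ := by positivity
  have hbal' : ∀ (s : Sd d) i, (E s).1 (eZ d i) = (E s).1 (-eZ d i) := fun s =>
    hbal (fun _ => s) 0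
  obtain ⟨p, hp, hmom⟩ := hmom
  set ν := μ.withDensity (abpWeight E) with hν
  have : IsFiniteMeasure ν := ⟨withDensity_abpWeight_univ_lt_top hp hd0 hbal' hell hmom⟩
  have hφ : Tendsto (fun t : ℝ≥0∞ => t ^ (d : ℝ)⁻¹) (𝓝 0) (𝓝 0) := by
    simpa only [ENNReal.zero_rpow_of_pos hdinv] using
      (ENNReal.continuous_rpow_const (y := (d : ℝ)⁻¹)).tendsto 0
  have hle : ∀ n B, MeasurableSet B → meanOccupation E μ (n + 1) B ≤ ν B ^ (d : ℝ)⁻¹ :=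
    fun n B hB => meanOccupation_le hd0 n.succ_pos hμ.1 hE hbal' hell hB
  obtain ⟨lam, hlim⟩ := exists_measure_tendsto_setwise _ ν hφ hle (hyperfilter ℕ)
  have hlam_le : ∀ B, MeasurableSet B → lam B ≤ ν B ^ (d : ℝ)⁻¹ := fun B hB =>
    le_of_tendsto (hlim B hB) (Eventually.of_forall fun n => hle n B hB)
  have hfin : IsFiniteMeasure lam := ⟨(hlam_le _ MeasurableSet.univ).trans_lt
    (ENNReal.rpow_lt_top_of_nonneg hdinv.le (measure_ne_top ν _))⟩
  have huniv : lam Set.univ ≠ 0 := by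
    have h : (2⁻¹ : ℝ≥0∞) ≤ lam Set.univ := ge_of_tendsto (hlim _ MeasurableSet.univ)
      (Eventually.of_forall fun n => half_le_meanOccupation_univ n.succ_pos hE hbal')
    exact (lt_of_lt_of_le (by simp) h).ne'
  have hac : lam ≪ μ := Measure.AbsolutelyContinuous.mk fun B hB h0 => by
    have h1 : ν B = 0 := withDensity_absolutelyContinuous μ _ h0
    simpa [h1, ENNReal.zero_rpow_of_pos hdinv] using hlam_le B hB
  have hL : Tendsto (fun n : ℕ => (((n + 1 : ℕ) : ℝ≥0∞) ^ 2)⁻¹) (hyperfilter ℕ) (𝓝 0) := by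
    refine Tendsto.mono_left ?_ (Nat.hyperfilter_le_atTop)
    have h := (tendsto_add_atTop_iff_nat 1).2 ENNReal.tendsto_inv_nat_nhds_zero
    refine tendsto_of_tendsto_of_tendsto_of_le_of_le tendsto_const_nhds h (fun _ => zero_le)
      fun n => ENNReal.inv_le_inv.2 ?_
    exact_mod_cast Nat.le_self_pow two_ne_zero (n + 1)
  have hsub : ∀ B, MeasurableSet B → ∫⁻ ω, Kker d E ω B ∂lam ≤ lam B := fun B hB =>
    lintegral_le_of_tendsto_setwise hlim (fun ω => Kker_ne_top E ω B)
      (Eventually.of_forall fun n => lintegral_Kker_meanOccupation_le hE hB)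
      (by simpa using hL.add (hlim B hB))
  have hinv : ∀ B, MeasurableSet B → ∫⁻ ω, Kker d E ω B ∂lam = lam B := by
    intro B hB
    refine le_antisymm (hsub B hB) ?_
    have h1 : ∫⁻ ω, Kker d E ω B ∂lam + ∫⁻ ω, Kker d E ω Bᶜ ∂lam = lam B + lam Bᶜ := by
      rw [← lintegral_add_left (measurable_Kker hE hB), measure_add_measure_compl hB]
      simp [Kker_add_compl]
    by_contra! hlt
    exact (ENNReal.add_lt_add_of_lt_of_le (ne_top_of_le_ne_top (measure_ne_top lam _)
      (hsub _ hB.compl)) hlt (hsub _ hB.compl)).ne h1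
  have : NeZero lam := ⟨fun h => huniv (by simp [h])⟩
  set lam' : Measure (Env d) := (lam Set.univ)⁻¹ • lam with hlam'
  have hprob : IsProbabilityMeasure lam' := isProbabilityMeasureSMul
  have hac' : lam' ≪ μ := hac.smul_left _
  have hinv' : ∀ B, MeasurableSet B → ∫⁻ ω, Kker d E ω B ∂lam' = lam' B := fun B hB => by
    rw [hlam', lintegral_smul_measure, hinv B hB, Measure.smul_apply]
  have hca := absolutelyContinuous_of_invariant hμ hE hell hac' hinv'
  refine ⟨lam', hprob, hac', hca, hinv', fun B hB hK => ?_⟩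
  rcases measure_eq_zero_or_one_of_ae_shift_mem hμ hB (by
    filter_upwards [hca.ae_le hK, hell] with ω h1 h2 hωB
    refine shiftE_mem_of_Kker_compl_eq_zero (h2 0) ?_
    have h3 := Kker_add_compl E ω B
    rw [h1, Set.indicator_of_mem hωB] at h3
    exact (ENNReal.add_right_inj ENNReal.one_ne_top).1 (h3.trans (add_zero 1).symm)) with h0 | h1
  · exact Or.inl (hac' h0)
  · exact Or.inr ((prob_compl_eq_zero_iff hB).1 (hac' ((prob_compl_eq_zero_iff hB).2 h1)))
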